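/- For every Peano continuum X (as a topological space), dim(X) ≤ S-dim(X) ≤ Hö-dim(X) ≤ 2·S-dim(X), where the infima are taken over all metrics generating the topology of X. -/

import Mathlib

open Set Metric Filter Topology

/-- `SXm X m ε`: smallest cardinality of a cover of `(X, m)` by connected subsets of
diameter `≤ ε`. -/
noncomputable def SXm (X : Type*) (m : MetricSpace X) (ε : ℝ) : ℕ :=
  letI := m
  sInf {n : ℕ | ∃ 𝒞 : Finset (Set X), 𝒞.card = n ∧
    (∀ S ∈ 𝒞, IsConnected S ∧ Metric.diam S ≤ ε) ∧ ⋃₀ (𝒞 : Set (Set X)) = Set.univ}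

/-- `NXm X m ε`: smallest cardinality of a cover of `(X, m)` by subsets of diameter `≤ ε`. -/
noncomputable def NXm (X : Type*) (m : MetricSpace X) (ε : ℝ) : ℕ :=
  letI := m
  sInf {n : ℕ | ∃ 𝒞 : Finset (Set X), 𝒞.card = n ∧
    (∀ S ∈ 𝒞, Metric.diam S ≤ ε) ∧ ⋃₀ (𝒞 : Set (Set X)) = Set.univ}

/-- The S-dimension of the metric space `(X, m)`. -/
noncomputable def SDimm (X : Type*) (m : MetricSpace X) : ENNReal :=
  Filter.limsup (fun ε : ℝ => ENNReal.ofReal (Real.log (SXm X m ε) / Real.log (1 / ε)))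
    (nhdsWithin 0 (Set.Ioi 0))

/-- The box-counting dimension of the metric space `(X, m)`. -/
noncomputable def BoxDimm (X : Type*) (m : MetricSpace X) : ENNReal :=
  Filter.limsup (fun ε : ℝ => ENNReal.ofReal (Real.log (NXm X m ε) / Real.log (1 / ε)))
    (nhdsWithin 0 (Set.Ioi 0))

/-- The Hölder dimension of the metric space `(X, m)`. -/
noncomputable def HoDimm (X : Type*) (m : MetricSpace X) : ENNReal :=
  letI := m
  sInf {α : ENNReal | 0 < α ∧ ∃ f : ℝ → X, f '' (Set.Icc 0 1) = Set.univ ∧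
    ∃ C : ℝ, 0 < C ∧ ∀ x ∈ Set.Icc (0:ℝ) 1, ∀ y ∈ Set.Icc (0:ℝ) 1,
      dist (f x) (f y) ≤ C * |x - y| ^ (α⁻¹.toReal)}

/-- `SegmentCover δ n p`: the list `p` is a concatenation of at most `n` lists of diameter
`≤ δ`. -/
inductive SegmentCover {X : Type*} [MetricSpace X] (δ : ℝ) : ℕ → List X → Prop
  | nil (n : ℕ) : SegmentCover δ n []
  | append {n : ℕ} {s p : List X} (hs : ∀ x ∈ s, ∀ y ∈ s, dist x y ≤ δ)
      (hp : SegmentCover δ n p) : SegmentCover δ (n + 1) (s ++ p)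

namespace SegmentCover

variable {X : Type*} [MetricSpace X] {δ δ' : ℝ} {n m : ℕ} {p q : List X}

theorem mono (h : SegmentCover δ n p) (hδ : δ ≤ δ') (hn : n ≤ m) : SegmentCover δ' m p := by
  induction h generalizing m with
  | nil n => exact .nil m
  | append hs _ ih =>
    obtain ⟨m, rfl⟩ := Nat.exists_eq_add_of_le' (Nat.one_le_of_lt hn)
    exact .append (fun x hx y hy => (hs x hx y hy).trans hδ) (ih (by omega))

theorem of_dist_le (h : ∀ x ∈ p, ∀ y ∈ p, dist x y ≤ δ) : SegmentCover δ 1 p := by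
  simpa using SegmentCover.append h (.nil 0)

theorem concat (hp : SegmentCover δ n p) (hq : SegmentCover δ m q) :
    SegmentCover δ (n + m) (p ++ q) := by
  induction hp with
  | nil n => exact hq.mono le_rfl (by omega)
  | append hs _ ih =>
    rw [List.append_assoc, Nat.add_right_comm]
    exact .append hs ih

theorem sublist (hp : SegmentCover δ n p) (h : q.Sublist p) : SegmentCover δ n q := by
  induction hp generalizing q with
  | nil n =>
    rw [List.sublist_nil.1 h]
    exact .nil n
  | append hs _ ih =>
    obtain ⟨q₁, q₂, rfl, h₁, h₂⟩ := List.sublist_append_iff.1 h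
    exact .append (fun x hx y hy => hs x (h₁.subset hx) y (h₁.subset hy)) (ih h₂)

theorem of_length_le (hδ : 0 ≤ δ) (h : p.length ≤ n) : SegmentCover δ n p := by
  induction p generalizing n with
  | nil => exact .nil n
  | cons x p ih =>
    obtain ⟨n, rfl⟩ := Nat.exists_eq_add_of_le' (Nat.one_le_of_lt h)
    exact .append (s := [x]) (by simpa using hδ) (ih (by simpa using h))

theorem flatten {r : ℝ} (hp : SegmentCover δ n p) {Q : List (List X)}
    (hQ : List.Forall₂ (fun x w => ∀ u ∈ w, dist u x ≤ r) p Q) :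
    SegmentCover (δ + 2 * r) n Q.flatten := by
  induction hp generalizing Q with
  | nil n =>
    rw [List.forall₂_nil_left_iff.1 hQ]
    exact .nil n
  | @append n s p hs _ ih =>
    have h₁ := List.forall₂_take s.length hQ
    have h₂ := List.forall₂_drop s.length hQ
    rw [List.take_left] at h₁
    rw [List.drop_left] at h₂
    rw [← List.take_append_drop s.length Q, List.flatten_append]
    refine .append ?_ (ih h₂)
    have key : ∀ u ∈ (Q.take s.length).flatten, ∃ x ∈ s, dist u x ≤ r := by
      clear h₂ hQ hs
      generalize Q.take s.length = Q' at h₁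
      induction h₁ with
      | nil => simp
      | cons h _ ih =>
        intro u hu
        rw [List.flatten_cons, List.mem_append] at hu
        rcases hu with hu | hu
        · exact ⟨_, List.mem_cons_self, h u hu⟩
        · obtain ⟨x, hx, hux⟩ := ih u hu
          exact ⟨x, List.mem_cons_of_mem _ hx, hux⟩
    intro u hu v hv
    obtain ⟨x, hx, hux⟩ := key u hu
    obtain ⟨y, hy, hvy⟩ := key v hv
    linarith [dist_triangle4 u x y v, hs x hx y hy, dist_comm y v]

/-- A segment cover yields a monotone labelling of positions by segments. -/
theorem exists_label (hp : SegmentCover δ n p) :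
    ∃ lab : ℕ → ℕ, Monotone lab ∧ (∀ a, lab a ≤ n) ∧
      ∀ a (ha : a < p.length) b (hb : b < p.length), lab a = lab b → dist p[a] p[b] ≤ δ := by
  induction hp with
  | nil n => exact ⟨fun _ => 0, monotone_const, fun _ => Nat.zero_le _, by simp⟩
  | @append n s p hs _ ih =>
    obtain ⟨lab, hmono, hle, hlab⟩ := ih
    refine ⟨fun a => if a < s.length then 0 else 1 + lab (a - s.length), ?_, ?_, ?_⟩
    · intro a b hab
      have := hmono (Nat.sub_le_sub_right hab s.length)
      dsimp only
      split_ifs <;> omega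
    · intro a
      have := hle (a - s.length)
      dsimp only
      split_ifs <;> omega
    · intro a ha b hb hab
      rw [List.length_append] at ha hb
      dsimp only at hab
      rw [List.getElem_append, List.getElem_append]
      split_ifs at hab ⊢ with h₁ h₂ h₂
      · exact hs _ (List.getElem_mem _) _ (List.getElem_mem _)
      · omega
      · omega
      · exact hlab _ _ _ _ (by omega)

end SegmentCover

/-- `IsWalk 𝒞 x y l`: `l` lists the positions and the members of `𝒞` used by a walk from `x`
to `y` in which consecutive positions lie in a common member of `𝒞`; `y` is not listed. -/
def IsWalk {X : Type*} (𝒞 : Finset (Set X)) : X → X → List (X × Set X) → Prop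
  | x, y, [] => x = y
  | x, y, e :: l => e.1 = x ∧ e.2 ∈ 𝒞 ∧ x ∈ e.2 ∧ ∃ z ∈ e.2, IsWalk 𝒞 z y l

namespace IsWalk

variable {X : Type*} {𝒞 𝒞' : Finset (Set X)} {x y z : X} {l l' : List (X × Set X)}

theorem append (h : IsWalk 𝒞 x y l) (h' : IsWalk 𝒞 y z l') : IsWalk 𝒞 x z (l ++ l') := by
  induction l generalizing x with
  | nil => cases h; exact h'
  | cons e l ih =>
    obtain ⟨h₁, h₂, h₃, w, hw, h₄⟩ := h
    exact ⟨h₁, h₂, h₃, w, hw, ih h₄⟩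

theorem snd_mem (h : IsWalk 𝒞 x y l) {e : X × Set X} (he : e ∈ l) : e.2 ∈ 𝒞 := by
  induction l generalizing x with
  | nil => simp at he
  | cons e' l ih =>
    obtain ⟨-, h₂, -, w, -, h₄⟩ := h
    rcases List.mem_cons.1 he with rfl | he
    · exact h₂
    · exact ih h₄ he

theorem fst_mem_snd (h : IsWalk 𝒞 x y l) {e : X × Set X} (he : e ∈ l) : e.1 ∈ e.2 := by
  induction l generalizing x with
  | nil => simp at he
  | cons e' l ih =>
    obtain ⟨h₁, -, h₃, w, -, h₄⟩ := h
    rcases List.mem_cons.1 he with rfl | he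
    · exact h₁ ▸ h₃
    · exact ih h₄ he

theorem exists_of_append_cons {a b : List (X × Set X)} {e : X × Set X}
    (h : IsWalk 𝒞 x y (a ++ e :: b)) : ∃ w ∈ e.2, IsWalk 𝒞 w y b := by
  induction a generalizing x with
  | nil => exact h.2.2.2
  | cons e' a ih =>
    obtain ⟨-, -, -, w, -, h₄⟩ := h
    exact ih h₄

/-- Loop erasure. -/
theorem exists_sublist_nodup (h : IsWalk 𝒞 x y l) :
    ∃ l', l'.Sublist l ∧ IsWalk 𝒞 x y l' ∧ (l'.map Prod.snd).Nodup := by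
  induction l generalizing x with
  | nil => exact ⟨[], List.Sublist.refl _, h, by simp⟩
  | cons e l ih =>
    obtain ⟨h₁, h₂, h₃, w, hw, h₄⟩ := h
    obtain ⟨l', hl', hwalk, hnd⟩ := ih h₄
    by_cases hmem : e.2 ∈ l'.map Prod.snd
    · obtain ⟨e', he', hee'⟩ := List.mem_map.1 hmem
      obtain ⟨a, b, rfl⟩ := List.append_of_mem he'
      obtain ⟨w', hw', hb⟩ := hwalk.exists_of_append_cons
      refine ⟨e :: b, ?_, ⟨h₁, h₂, h₃, w', hee' ▸ hw', hb⟩, ?_⟩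
      · exact List.Sublist.cons_cons e
          (((List.sublist_cons_self e' b).trans (List.sublist_append_right a _)).trans hl')
      · rw [List.map_append, List.map_cons, hee'] at hnd
        simpa using hnd.of_append_right
    · exact ⟨e :: l', List.Sublist.cons_cons e hl', ⟨h₁, h₂, h₃, w, hw, hwalk⟩, by
        rw [List.map_cons]; exact List.nodup_cons.2 ⟨hmem, hnd⟩⟩

/-- Refinement of a walk along a finer family of sets. -/
theorem exists_refinement (h : IsWalk 𝒞 x y l)
    (H : ∀ B ∈ 𝒞, ∀ u ∈ B, ∀ v ∈ B, ∃ w, IsWalk 𝒞' u v w ∧ ∀ e ∈ w, e.1 ∈ B) :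
    ∃ Q : List (List (X × Set X)), IsWalk 𝒞' x y Q.flatten ∧
      List.Forall₂ (fun e w => ∀ e' ∈ w, e'.1 ∈ e.2) l Q := by
  induction l generalizing x with
  | nil => exact ⟨[], h, .nil⟩
  | cons e l ih =>
    obtain ⟨h₁, h₂, h₃, w, hw, h₄⟩ := h
    obtain ⟨Q, hQ, hlQ⟩ := ih h₄
    obtain ⟨q, hq, hqe⟩ := H e.2 h₂ x h₃ w hw
    exact ⟨q :: Q, hq.append hQ, .cons hqe hlQ⟩

end IsWalk

/-- `IsPath η x y p`: the list `p` starts at `x`, has jumps `≤ η`, and a last jump of length `≤ η`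
leads to the unlisted point `y`. -/
def IsPath {X : Type*} [MetricSpace X] (η : ℝ) : X → X → List X → Prop
  | x, y, [] => x = y
  | x, y, u :: p => u = x ∧ ∃ z, dist x z ≤ η ∧ IsPath η z y p

namespace IsPath

variable {X : Type*} [MetricSpace X] {η : ℝ} {x y z : X} {p q : List X}

theorem append (h : IsPath η x y p) (h' : IsPath η y z q) : IsPath η x z (p ++ q) := by
  induction p generalizing x with
  | nil => cases h; exact h'
  | cons u p ih =>
    obtain ⟨h₁, w, hw, h₂⟩ := h
    exact ⟨h₁, w, hw, ih h₂⟩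

theorem flatMap {ι : Type*} {L : List ι} {e : ι → List X} (h : ∀ i ∈ L, IsPath η x x (e i)) :
    IsPath η x x (L.flatMap e) := by
  induction L with
  | nil => rfl
  | cons i L ih =>
    rw [List.flatMap_cons]
    exact (h i List.mem_cons_self).append (ih fun j hj => h j (List.mem_cons_of_mem _ hj))

theorem dist_getElem_succ (h : IsPath η x y p) (a : ℕ) (ha : a + 1 < p.length) :
    dist p[a] p[a + 1] ≤ η := by
  induction p generalizing x a with
  | nil => simp at ha
  | cons u p ih =>
    obtain ⟨rfl, w, hw, h₂⟩ := h
    cases a with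
    | zero =>
      cases p with
      | nil => simp at ha
      | cons v p =>
        obtain ⟨rfl, -⟩ := h₂
        simpa using hw
    | succ a => simpa using ih h₂ a (by simpa using ha)

end IsPath

theorem IsWalk.isPath {X : Type*} [MetricSpace X] {𝒞 : Finset (Set X)} {η : ℝ} {x y : X}
    {l : List (X × Set X)} (h : IsWalk 𝒞 x y l)
    (h𝒞 : ∀ A ∈ 𝒞, ∀ x ∈ A, ∀ y ∈ A, dist x y ≤ η) : IsPath η x y (l.map Prod.fst) := by
  induction l generalizing x with
  | nil => exact h
  | cons e l ih =>
    obtain ⟨h₁, h₂, h₃, w, hw, h₄⟩ := h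
    exact ⟨h₁, w, h𝒞 _ h₂ x h₃ w hw, ih h₄⟩

theorem SegmentCover.flatMap {X ι : Type*} [MetricSpace X] {δ : ℝ} {L : List ι} {n : ι → ℕ}
    {e : ι → List X} (h : ∀ i ∈ L, SegmentCover δ (n i) (e i)) :
    SegmentCover δ (L.map n).sum (L.flatMap e) := by
  induction L with
  | nil => exact .nil _
  | cons i L ih =>
    rw [List.flatMap_cons, List.map_cons, List.sum_cons]
    exact (h i List.mem_cons_self).concat (ih fun j hj => h j (List.mem_cons_of_mem _ hj))

/-- A connected set covered by finitely many closed sets is traversed by walks along them. -/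
theorem IsPreconnected.exists_isWalk {X : Type*} [TopologicalSpace X] {A : Set X}
    (hA : IsPreconnected A) {𝒞 : Finset (Set X)} (hcl : ∀ B ∈ 𝒞, IsClosed B)
    (hcov : ∀ x, ∃ B ∈ 𝒞, x ∈ B) {x y : X} (hx : x ∈ A) (hy : y ∈ A) :
    ∃ l, IsWalk 𝒞 x y l ∧ ∀ e ∈ l, e.1 ∈ A := by
  classical
  let R : Set X := {u | u ∈ A ∧ ∃ l, IsWalk 𝒞 x u l ∧ ∀ e ∈ l, e.1 ∈ A}
  have hR : ∀ B ∈ 𝒞, ∀ u ∈ R, u ∈ B → ∀ v ∈ A, v ∈ B → v ∈ R := by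
    rintro B hB u ⟨hu, l, hl, hlA⟩ huB v hv hvB
    refine ⟨hv, l ++ [(u, B)], hl.append ⟨rfl, hB, huB, v, hvB, rfl⟩, ?_⟩
    intro e he
    rcases List.mem_append.1 he with he | he
    · exact hlA e he
    · rw [List.mem_singleton.1 he]; exact hu
  have hxR : x ∈ R := ⟨hx, [], rfl, by simp⟩
  suffices y ∈ R from this.2
  by_contra hyR
  let 𝒰 := 𝒞.filter fun B => (B ∩ R).Nonempty
  let 𝒱 := 𝒞.filter fun B => ¬ (B ∩ R).Nonempty
  have hclU : ∀ 𝒲 ⊆ 𝒞, IsClosed (⋃ B ∈ 𝒲, B) := fun 𝒲 h𝒲 =>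
    Set.Finite.isClosed_biUnion 𝒲.finite_toSet fun B hB => hcl B (h𝒲 hB)
  obtain ⟨Bx, hBx, hxB⟩ := hcov x
  obtain ⟨By, hBy, hyB⟩ := hcov y
  obtain ⟨z, hzA, hz₁, hz₂⟩ := isPreconnected_closed_iff.1 hA (⋃ B ∈ 𝒰, B) (⋃ B ∈ 𝒱, B)
    (hclU _ (Finset.filter_subset _ _)) (hclU _ (Finset.filter_subset _ _))
    (by
      intro u _
      obtain ⟨B, hB, huB⟩ := hcov u
      by_cases h : (B ∩ R).Nonempty
      · exact Or.inl (Set.mem_biUnion (Finset.mem_filter.2 ⟨hB, h⟩) huB)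
      · exact Or.inr (Set.mem_biUnion (Finset.mem_filter.2 ⟨hB, h⟩) huB))
    ⟨x, hx, Set.mem_biUnion (Finset.mem_filter.2 ⟨hBx, x, hxB, hxR⟩) hxB⟩
    ⟨y, hy, Set.mem_biUnion (Finset.mem_filter.2 ⟨hBy, fun ⟨u, huB, hu⟩ =>
      hyR (hR By hBy u hu huB y hy hyB)⟩) hyB⟩
  obtain ⟨B, hB, hzB⟩ := Set.mem_iUnion₂.1 hz₁
  obtain ⟨B', hB', hzB'⟩ := Set.mem_iUnion₂.1 hz₂
  obtain ⟨hB, u, huB, hu⟩ := Finset.mem_filter.1 hB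
  exact (Finset.mem_filter.1 hB').2 ⟨z, hzB', hR B hB u hu huB z hzA hzB⟩

/-- A sequence of finite covers by closed connected sets, of mesh halving at each step, the first
of which is a single set. -/
structure ConnectedScales (X : Type*) [MetricSpace X] where
  mesh : ℕ → ℝ
  mesh_nonneg : ∀ k, 0 ≤ mesh k
  mesh_succ : ∀ k, mesh (k + 1) = mesh k / 2
  cover : ℕ → Finset (Set X)
  isClosed : ∀ k, ∀ A ∈ cover k, IsClosed A
  isConnected : ∀ k, ∀ A ∈ cover k, IsConnected A
  dist_le : ∀ k, ∀ A ∈ cover k, ∀ x ∈ A, ∀ y ∈ A, dist x y ≤ mesh k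
  exists_mem : ∀ k x, ∃ A ∈ cover k, x ∈ A
  card_cover_zero : (cover 0).card ≤ 1

namespace ConnectedScales

variable {X : Type*} [MetricSpace X] (S : ConnectedScales X)

/-- Inside a set of the `j`-th cover, any two points are joined by a walk at scale `K ≥ j` which
at each intermediate scale `k` is made of at most `card (cover k)` pieces. -/
theorem exists_walk {j K : ℕ} (hjK : j ≤ K) {A : Set X} (hA : A ∈ S.cover j) {x y : X}
    (hx : x ∈ A) (hy : y ∈ A) :
    ∃ l, IsWalk (S.cover K) x y l ∧
      (∀ e ∈ l, dist e.1 x ≤ 2 * S.mesh j - 2 * S.mesh K) ∧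
      ∀ k, j ≤ k → k ≤ K →
        SegmentCover (4 * S.mesh k - 4 * S.mesh K) (S.cover k).card (l.map Prod.fst) := by
  induction K, hjK using Nat.le_induction with
  | base =>
    refine ⟨[(x, A)], ⟨rfl, hA, hx, y, hy, rfl⟩, by simp, fun k hk hk' => ?_⟩
    obtain rfl := le_antisymm hk hk'
    exact .of_length_le (by simp) (by simpa using ⟨A, hA⟩)
  | succ K hjK ih =>
    obtain ⟨l, hl, hdist, hseg⟩ := ih
    obtain ⟨Q, hQ, hlQ⟩ := hl.exists_refinement (𝒞' := S.cover (K + 1)) fun B hB u hu v hv =>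
      (S.isConnected K B hB).isPreconnected.exists_isWalk (S.isClosed _) (S.exists_mem _) hu hv
    obtain ⟨l', hsub, hl', hnd⟩ := hQ.exists_sublist_nodup
    have hmesh := S.mesh_succ K
    have hclose : List.Forall₂ (fun e w => ∀ e' ∈ w, dist e'.1 e.1 ≤ S.mesh K) l Q := by
      rw [List.forall₂_iff_zip] at hlQ ⊢
      refine ⟨hlQ.1, fun {e w} hew e' he' => ?_⟩
      have hel := (List.of_mem_zip hew).1
      exact S.dist_le K _ (hl.snd_mem hel) _ (hlQ.2 hew e' he') _ (hl.fst_mem_snd hel)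
    refine ⟨l', hl', fun e he => ?_, fun k hk hk' => ?_⟩
    · obtain ⟨w, hw, hew⟩ := List.mem_flatten.1 (hsub.subset he)
      obtain ⟨i, hi, rfl⟩ := List.mem_iff_getElem.1 hw
      have hi' : i < l.length := hclose.length_eq ▸ hi
      have h₁ := (List.forall₂_iff_get.1 hclose).2 i hi' hi e hew
      have h₂ := hdist _ (List.getElem_mem hi')
      rw [List.get_eq_getElem] at h₁
      linarith [dist_triangle e.1 l[i].1 x]
    · rcases hk'.lt_or_eq with hk' | rfl
      · refine (SegmentCover.flatten (r := S.mesh K) (hseg k hk (by omega))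
          (Q := Q.map (List.map Prod.fst)) ?_).sublist ?_ |>.mono (by linarith) le_rfl
        · rw [List.forall₂_map_left_iff, List.forall₂_map_right_iff]
          refine hclose.imp fun e w h u hu => ?_
          obtain ⟨e', he', rfl⟩ := List.mem_map.1 hu
          exact h e' he'
        · rw [← List.map_flatten]
          exact hsub.map _
      · refine .of_length_le (by simp) ?_
        classical
        rw [List.length_map, ← List.length_map (f := Prod.snd), ← List.toFinset_card_of_nodup hnd]
        refine Finset.card_le_card fun B hB => ?_
        obtain ⟨e, he, rfl⟩ := List.mem_map.1 (List.mem_toFinset.1 hB)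
        exact hl'.snd_mem he

theorem exists_path {j K : ℕ} (hjK : j ≤ K) {A : Set X} (hA : A ∈ S.cover j) {x y : X}
    (hx : x ∈ A) (hy : y ∈ A) :
    ∃ p, IsPath (S.mesh K) x y p ∧ (∀ u ∈ p, dist u x ≤ 2 * S.mesh j) ∧
      ∀ k, j ≤ k → k ≤ K → SegmentCover (6 * S.mesh k) (S.cover k).card p := by
  obtain ⟨l, hl, hdist, hseg⟩ := S.exists_walk hjK hA hx hy
  have hK := S.mesh_nonneg K
  refine ⟨l.map Prod.fst, hl.isPath (S.dist_le K), ?_, fun k hk hk' => ?_⟩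
  · intro u hu
    obtain ⟨e, he, rfl⟩ := List.mem_map.1 hu
    linarith [hdist e he]
  · exact (hseg k hk hk').mono (by linarith [S.mesh_nonneg k]) le_rfl

theorem mesh_le_of_le {i k : ℕ} (h : i ≤ k) : S.mesh k ≤ S.mesh i := by
  induction k, h using Nat.le_induction with
  | base => exact le_rfl
  | succ k _ ih => linarith [S.mesh_succ k, S.mesh_nonneg k]

theorem exists_tours {seed : Set X → X} (hseed : ∀ k, ∀ A ∈ S.cover k, seed A ∈ A) {k K : ℕ}
    (hk : k ≤ K) :
    ∃ (T : Set X → List X) (c : ℕ → Set X → ℕ),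
      (∀ A ∈ S.cover k, IsPath (S.mesh K) (seed A) (seed A) (T A)) ∧
      (∀ A ∈ S.cover k, ∀ u ∈ T A, dist u (seed A) ≤ 3 * S.mesh k) ∧
      (∀ B ∈ S.cover K, ∃ A ∈ S.cover k, seed B ∈ T A) ∧
      (∀ i, k ≤ i → i ≤ K → ∀ A ∈ S.cover k, SegmentCover (6 * S.mesh i) (c i A) (T A)) ∧
      ∀ i, k ≤ i → i ≤ K →
        ∑ A ∈ S.cover k, c i A + 2 * (S.cover i).card * (S.cover k).card ≤
          (2 * (S.cover i).card + 1) * ∑ m ∈ Finset.Icc k i, (S.cover m).card := by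
  classical
  induction hk using Nat.decreasingInduction with
  | self =>
    refine ⟨fun A => [seed A], fun _ _ => 1, fun A _ => ?_, fun A _ => ?_, fun B hB => ?_,
      fun i hi hi' A _ => ?_, fun i hi hi' => ?_⟩
    · exact ⟨rfl, seed A, by simpa using S.mesh_nonneg K, rfl⟩
    · simpa using S.mesh_nonneg K
    · exact ⟨B, hB, by simp⟩
    · exact .of_length_le (by linarith [S.mesh_nonneg i]) (by simp)
    · obtain rfl := le_antisymm hi hi'
      simp
      nlinarith
  | of_succ k hk ih =>
    obtain ⟨T, c, hpath, hdist, hmem, hseg, hsum⟩ := ih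
    have hstep : ∀ B, ∃ A p, B ∈ S.cover (k + 1) → A ∈ S.cover k ∧
        IsPath (S.mesh K) (seed A) (seed A) p ∧ (∀ u ∈ p, dist u (seed A) ≤ 3 * S.mesh k) ∧
        (∀ u ∈ T B, u ∈ p) ∧ ∀ i, k + 1 ≤ i → i ≤ K →
          SegmentCover (6 * S.mesh i) (2 * (S.cover i).card + c i B) p := by
      intro B
      by_cases hB : B ∈ S.cover (k + 1)
      swap
      · exact ⟨B, [], fun h => absurd h hB⟩
      obtain ⟨A, hA, hBA⟩ := S.exists_mem k (seed B)
      obtain ⟨p, hp, hpd, hps⟩ := S.exists_path hk.le hA (hseed k A hA) hBA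
      obtain ⟨q, hq, hqd, hqs⟩ := S.exists_path hk.le hA hBA (hseed k A hA)
      have hAB := S.dist_le k A hA _ hBA _ (hseed k A hA)
      have hmesh := S.mesh_succ k
      have hmesh0 := S.mesh_nonneg k
      refine ⟨A, p ++ (T B ++ q), fun _ => ⟨hA, hp.append ((hpath B hB).append hq), ?_, ?_, ?_⟩⟩
      · intro u hu
        rcases List.mem_append.1 hu with hu | hu
        · linarith [hpd u hu]
        rcases List.mem_append.1 hu with hu | hu
        · linarith [hdist B hB u hu, dist_triangle u (seed B) (seed A)]
        · linarith [hqd u hu, dist_triangle u (seed B) (seed A)]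
      · intro u hu
        simp [hu]
      · intro i hi hi'
        refine ((hps i (by omega) hi').concat
          ((hseg i hi hi' B hB).concat (hqs i (by omega) hi'))).mono le_rfl ?_
        omega
    choose par e he using hstep
    let ch : Set X → Finset (Set X) := fun A => (S.cover (k + 1)).filter fun B => par B = A
    have hch : ∀ {A B}, B ∈ ch A → B ∈ S.cover (k + 1) ∧ par B = A := fun h => Finset.mem_filter.1 h
    have hdist' : ∀ A ∈ S.cover k, ∀ u ∈ (ch A).toList.flatMap e,
        dist u (seed A) ≤ 3 * S.mesh k := by
      intro A _ u hu
      obtain ⟨B, hB, huB⟩ := List.mem_flatMap.1 hu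
      obtain ⟨hB', rfl⟩ := hch (Finset.mem_toList.1 hB)
      exact (he B hB').2.2.1 u huB
    refine ⟨fun A => (ch A).toList.flatMap e,
      fun i A => if i = k then 1 else ∑ B ∈ ch A, (2 * (S.cover i).card + c i B),
      fun A hA => ?_, hdist', fun B hB => ?_, fun i hi hi' A hA => ?_, fun i hi hi' => ?_⟩
    · refine IsPath.flatMap fun B hB => ?_
      obtain ⟨hB', rfl⟩ := hch (Finset.mem_toList.1 hB)
      exact (he B hB').2.1
    · obtain ⟨A, hA, hBA⟩ := hmem B hB
      refine ⟨par A, (he A hA).1, List.mem_flatMap.2 ⟨A, ?_, (he A hA).2.2.2.1 _ hBA⟩⟩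
      exact Finset.mem_toList.2 (Finset.mem_filter.2 ⟨hA, rfl⟩)
    · dsimp only
      split_ifs with hik
      · subst hik
        refine .of_dist_le fun u hu v hv => ?_
        linarith [hdist' A hA u hu, hdist' A hA v hv, dist_triangle_right u v (seed A)]
      · rw [← Finset.sum_map_toList]
        refine .flatMap fun B hB => ?_
        have hB := (hch (Finset.mem_toList.1 hB)).1
        exact (he B hB).2.2.2.2 i (by omega) hi'
    · dsimp only
      rw [← Finset.add_sum_Ioc_eq_sum_Icc hi, ← Finset.Icc_add_one_left_eq_Ioc]
      split_ifs with hik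
      · subst hik
        simp
        nlinarith
      · rw [Finset.sum_fiberwise_of_maps_to fun B hB => (he B hB).1]
        have := hsum i (by omega) hi'
        rw [Finset.sum_add_distrib, Finset.sum_const, smul_eq_mul]
        nlinarith

/-- The number of segments of diameter `≤ 6 * mesh i` used by the tours of the whole space. -/
def segmentCount (i : ℕ) : ℕ :=
  (2 * (S.cover i).card + 1) * ∑ m ∈ Finset.range (i + 1), (S.cover m).card

theorem exists_tour [Nonempty X] (K : ℕ) :
    ∃ (x : X) (p : List X), IsPath (S.mesh K) x x p ∧ (∀ z, ∃ u ∈ p, dist z u ≤ S.mesh K) ∧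
      ∀ i ≤ K, SegmentCover (6 * S.mesh i) (S.segmentCount i) p := by
  classical
  have hne : ∀ A : Set X, ∃ x, A.Nonempty → x ∈ A := fun A => by
    by_cases h : A.Nonempty
    · exact ⟨h.some, fun _ => h.some_mem⟩
    · exact ⟨Classical.arbitrary X, fun h' => absurd h' h⟩
  choose seed hseed using hne
  have hseed' : ∀ k, ∀ A ∈ S.cover k, seed A ∈ A := fun k A hA =>
    hseed A (S.isConnected k A hA).nonempty
  obtain ⟨T, c, hpath, -, hmem, hseg, hsum⟩ := S.exists_tours hseed' K.zero_le
  obtain ⟨A, hA, -⟩ := S.exists_mem 0 (Classical.arbitrary X)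
  refine ⟨seed A, T A, hpath A hA, fun z => ?_, fun i hi => ?_⟩
  · obtain ⟨B, hB, hzB⟩ := S.exists_mem K z
    obtain ⟨A', hA', hBA⟩ := hmem B hB
    rw [Finset.card_le_one.1 S.card_cover_zero A' hA' A hA] at hBA
    exact ⟨seed B, hBA, S.dist_le K B hB _ hzB _ (hseed' K B hB)⟩
  · refine (hseg i i.zero_le hi A hA).mono le_rfl ?_
    have h₁ := hsum i i.zero_le hi
    have h₂ := Finset.single_le_sum (f := c i) (fun _ _ => Nat.zero_le _) hA
    rw [segmentCount, Finset.range_eq_Ico, Finset.Ico_add_one_right_eq_Icc]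
    omega

theorem dist_le_mesh_zero (x y : X) : dist x y ≤ S.mesh 0 := by
  obtain ⟨A, hA, hx⟩ := S.exists_mem 0 x
  obtain ⟨B, hB, hy⟩ := S.exists_mem 0 y
  rw [Finset.card_le_one.1 S.card_cover_zero B hB A hA] at hy
  exact S.dist_le 0 A hA x hx y hy

/-- A parametrization of the tour at scale `K` which is Hölder up to an error `7 * mesh K`. -/
theorem exists_almost_holder [Nonempty X] {α T : ℝ} (hα : 0 < α) (hT : 0 < T) (K : ℕ)
    (hsum : ∑ i ∈ Finset.range (K + 1), S.mesh i ^ α * S.segmentCount i ≤ T) :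
    ∃ f : ℝ → X,
      (∀ s t, s ≤ t → dist (f s) (f t) ≤ 12 * (T * (t - s)) ^ α⁻¹ + 7 * S.mesh K) ∧
      ∀ z, ∃ t ∈ Set.Icc (0 : ℝ) 1, dist z (f t) ≤ 7 * S.mesh K := by
  classical
  obtain ⟨x, p, hp, hdense, hseg⟩ := S.exists_tour K
  have hlab : ∀ i, ∃ lab : ℕ → ℕ, i ≤ K → Monotone lab ∧ (∀ a, lab a ≤ S.segmentCount i) ∧
      ∀ a (ha : a < p.length) b (hb : b < p.length), lab a = lab b →
        dist p[a] p[b] ≤ 6 * S.mesh i := by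
    intro i
    by_cases hi : i ≤ K
    · obtain ⟨lab, h⟩ := (hseg i hi).exists_label
      exact ⟨lab, fun _ => h⟩
    · exact ⟨id, fun h => absurd h hi⟩
  choose lab hlab using hlab
  have hpos : 0 < p.length := by
    obtain ⟨u, hu, -⟩ := hdense x
    exact List.length_pos_of_mem hu
  have hmK := S.mesh_nonneg K
  set τ : ℕ → ℝ := fun a => ∑ i ∈ Finset.range (K + 1), S.mesh i ^ α * lab i a with hτ
  have hw : ∀ i, 0 ≤ S.mesh i ^ α := fun i => Real.rpow_nonneg (S.mesh_nonneg i) α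
  have hτ0 : ∀ a, 0 ≤ τ a := fun a =>
    Finset.sum_nonneg fun i _ => mul_nonneg (hw i) (Nat.cast_nonneg _)
  have hτT : ∀ a, τ a ≤ T := fun a => (Finset.sum_le_sum fun i hi =>
    mul_le_mul_of_nonneg_left (Nat.cast_le.2 ((hlab i (by simpa [Nat.lt_succ_iff] using hi)).2.1 a))
      (hw i)).trans hsum
  have hτmono : Monotone τ := fun a b hab => Finset.sum_le_sum fun i hi =>
    mul_le_mul_of_nonneg_left (Nat.cast_le.2 ((hlab i (by simpa [Nat.lt_succ_iff] using hi)).1 hab))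
      (hw i)
  have key : ∀ a (ha : a < p.length) b (hb : b < p.length), a ≤ b →
      dist p[a] p[b] ≤ 12 * (τ b - τ a) ^ α⁻¹ + 6 * S.mesh K := by
    intro a ha b hb hab
    have hnn : 0 ≤ (τ b - τ a) ^ α⁻¹ := Real.rpow_nonneg (sub_nonneg.2 (hτmono hab)) _
    by_cases hall : ∀ i ≤ K, lab i a = lab i b
    · linarith [(hlab K le_rfl).2.2 a ha b hb (hall K le_rfl)]
    push Not at hall
    have hi := Nat.find_spec hall
    have hmin := fun j (hj : j < Nat.find hall) => Nat.find_min hall hj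
    set i := Nat.find hall
    have hlt : lab i a + 1 ≤ lab i b := lt_of_le_of_ne ((hlab i hi.1).1 hab) hi.2
    have hle : S.mesh i ^ α ≤ τ b - τ a := by
      rw [hτ]
      simp only
      rw [← Finset.sum_sub_distrib]
      refine le_trans ?_ (Finset.single_le_sum (fun j hj => ?_)
        (Finset.mem_range.2 (Nat.lt_succ_of_le hi.1)))
      · have : (lab i a : ℝ) + 1 ≤ lab i b := by exact_mod_cast hlt
        nlinarith [hw i]
      · rw [← mul_sub]
        refine mul_nonneg (hw j) (sub_nonneg.2 (Nat.cast_le.2 ?_))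
        exact (hlab j (Nat.lt_succ_iff.1 (Finset.mem_range.1 hj))).1 hab
    have hmesh : S.mesh i ≤ (τ b - τ a) ^ α⁻¹ := by
      have := Real.rpow_le_rpow (hw i) hle (inv_nonneg.2 hα.le)
      rwa [Real.rpow_rpow_inv (S.mesh_nonneg i) hα.ne'] at this
    suffices dist p[a] p[b] ≤ 12 * S.mesh i by linarith
    rcases Nat.eq_zero_or_eq_succ_pred i with h0 | hsucc
    · rw [h0]
      linarith [S.dist_le_mesh_zero p[a] p[b], S.mesh_nonneg 0]
    · have hlt' : i.pred < i := by omega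
      have heq : lab i.pred a = lab i.pred b := by
        by_contra hne
        exact hmin _ hlt' ⟨by omega, hne⟩
      have h₁ := (hlab i.pred (by omega)).2.2 a ha b hb heq
      rw [hsucc, S.mesh_succ]
      linarith
  let idx : ℝ → ℕ := fun t => Nat.findGreatest (fun a => τ a ≤ t * T) (p.length - 1)
  have hidx : ∀ t, idx t < p.length := fun t =>
    lt_of_le_of_lt (Nat.findGreatest_le _) (by omega)
  have hidxmono : ∀ s t, s ≤ t → idx s ≤ idx t := fun s t hst =>
    Nat.findGreatest_mono (fun a (ha : τ a ≤ s * T) =>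
      ha.trans (mul_le_mul_of_nonneg_right hst hT.le)) le_rfl
  refine ⟨fun t => p[idx t]'(hidx t), fun s t hst => ?_, fun z => ?_⟩
  · have hnn : 0 ≤ (T * (t - s)) ^ α⁻¹ :=
      Real.rpow_nonneg (mul_nonneg hT.le (sub_nonneg.2 hst)) _
    rcases (hidxmono s t hst).eq_or_lt with heq | hlt
    · simp only [heq, dist_self]
      positivity
    · have hnext := hp.dist_getElem_succ (idx s) (lt_of_le_of_lt hlt (hidx t))
      have h₁ := key (idx s + 1) (lt_of_le_of_lt hlt (hidx t)) (idx t) (hidx t) hlt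
      have h₂ : ¬ τ (idx s + 1) ≤ s * T :=
        Nat.findGreatest_is_greatest (P := fun a => τ a ≤ s * T) (n := p.length - 1)
          (Nat.lt_succ_self _) (Nat.le_sub_one_of_lt (lt_of_le_of_lt hlt (hidx t)))
      have h₃ : τ (idx t) ≤ t * T := Nat.findGreatest_of_ne_zero rfl (by omega : idx t ≠ 0)
      have h₄ : (τ (idx t) - τ (idx s + 1)) ^ α⁻¹ ≤ (T * (t - s)) ^ α⁻¹ :=
        Real.rpow_le_rpow (sub_nonneg.2 (hτmono hlt)) (by nlinarith) (inv_nonneg.2 hα.le)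
      linarith [dist_triangle (p[idx s]'(hidx s))
        (p[idx s + 1]'(lt_of_le_of_lt hlt (hidx t))) (p[idx t]'(hidx t))]
  · obtain ⟨u, hu, hzu⟩ := hdense z
    obtain ⟨a, ha, rfl⟩ := List.mem_iff_getElem.1 hu
    refine ⟨τ a / T, ⟨div_nonneg (hτ0 a) hT.le, (div_le_one hT).2 (hτT a)⟩, ?_⟩
    have hdiv : τ a / T * T = τ a := div_mul_cancel₀ _ hT.ne'
    have h₁ : a ≤ idx (τ a / T) := Nat.le_findGreatest (by omega) hdiv.ge
    have h₂ : τ (idx (τ a / T)) ≤ τ a / T * T :=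
      Nat.findGreatest_spec (P := fun b => τ b ≤ τ a / T * T) (m := a) (by omega) hdiv.ge
    have h₃ := key a ha _ (hidx (τ a / T)) h₁
    rw [le_antisymm (h₂.trans_eq hdiv) (hτmono h₁), sub_self,
      Real.zero_rpow (inv_ne_zero hα.ne')] at h₃
    linarith [dist_triangle z p[a] (p[idx (τ a / T)]'(hidx _))]

end ConnectedScales

/-- A sequence of almost Hölder maps with asymptotically dense images yields, in a compact space,
a Hölder surjection. -/
theorem exists_holder_surjection_of_almost {X : Type*} [MetricSpace X] [CompactSpace X]
    {C β : ℝ} (hβ : 0 < β) {η : ℕ → ℝ} (hη : Tendsto η atTop (𝓝 0)) {F : ℕ → ℝ → X}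
    (hF : ∀ K, ∀ s ∈ Set.Icc (0 : ℝ) 1, ∀ t ∈ Set.Icc (0 : ℝ) 1,
      dist (F K s) (F K t) ≤ C * |s - t| ^ β + η K)
    (hdense : ∀ K z, ∃ t ∈ Set.Icc (0 : ℝ) 1, dist z (F K t) ≤ η K) :
    ∃ f : ℝ → X, f '' Set.Icc 0 1 = Set.univ ∧
      ∀ s ∈ Set.Icc (0 : ℝ) 1, ∀ t ∈ Set.Icc (0 : ℝ) 1, dist (f s) (f t) ≤ C * |s - t| ^ β := by
  let U : Ultrafilter ℕ := Filter.hyperfilter ℕ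
  have hU : (U : Filter ℕ) ≤ atTop := Nat.hyperfilter_le_atTop
  have hlim : ∀ t, ∃ x, Tendsto (fun K => F K t) U (𝓝 x) := fun t => by
    obtain ⟨x, -, hx⟩ := isCompact_univ.ultrafilter_le_nhds (U.map fun K => F K t) (by simp)
    exact ⟨x, hx⟩
  choose f hf using hlim
  have hηU := hη.mono_left hU
  refine ⟨f, Set.eq_univ_of_forall fun z => ?_, fun s hs t ht => ?_⟩
  · choose t ht htz using fun K => hdense K z
    obtain ⟨t₀, ht₀, hlim⟩ := (isCompact_Icc (a := (0 : ℝ)) (b := 1)).ultrafilter_le_nhds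
      (U.map t) (Filter.le_principal_iff.2 (Filter.mem_map.2 (Filter.univ_mem' ht)))
    have hlim : Tendsto t U (𝓝 t₀) := hlim
    refine ⟨t₀, ht₀, dist_le_zero.1 ?_⟩
    have hpow : Tendsto (fun K => |t₀ - t K| ^ β) U (𝓝 0) := by
      have h : Tendsto (fun K => |t₀ - t K|) U (𝓝 0) := by
        simpa using (tendsto_const_nhds.sub hlim).abs (a := t₀ - t₀)
      simpa [Real.zero_rpow hβ.ne'] using h.rpow_const (p := β) (Or.inr hβ.le)
    refine le_of_tendsto_of_tendsto' ((hf t₀).dist tendsto_const_nhds)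
      (g := fun K => (C * |t₀ - t K| ^ β + η K) + η K) ?_ fun K => ?_
    · simpa using ((hpow.const_mul C).add hηU).add hηU
    · exact (dist_triangle _ (F K (t K)) _).trans
        (add_le_add (hF K _ ht₀ _ (ht K)) (by rw [dist_comm]; exact htz K))
  · refine le_of_tendsto_of_tendsto' ((hf s).dist (hf t))
      (g := fun K => C * |s - t| ^ β + η K) ?_ fun K => hF K s hs t ht
    simpa using tendsto_const_nhds.add hηU

theorem ConnectedScales.mesh_eq {X : Type*} [MetricSpace X] (S : ConnectedScales X) (k : ℕ) :
    S.mesh k = S.mesh 0 * (1 / 2) ^ k := by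
  induction k with
  | zero => simp
  | succ k ih => rw [S.mesh_succ, ih]; ring

theorem ConnectedScales.exists_holder_surjection {X : Type*} [MetricSpace X] [CompactSpace X]
    [Nonempty X] (S : ConnectedScales X) {α : ℝ} (hα : 0 < α)
    (hsum : Summable fun i => S.mesh i ^ α * S.segmentCount i) :
    ∃ f : ℝ → X, f '' Set.Icc 0 1 = Set.univ ∧ ∃ C : ℝ, 0 < C ∧
      ∀ s ∈ Set.Icc (0 : ℝ) 1, ∀ t ∈ Set.Icc (0 : ℝ) 1, dist (f s) (f t) ≤ C * |s - t| ^ α⁻¹ := by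
  set T : ℝ := ∑' i, S.mesh i ^ α * S.segmentCount i + 1 with hT
  have hnn : ∀ i, 0 ≤ S.mesh i ^ α * S.segmentCount i := fun i =>
    mul_nonneg (Real.rpow_nonneg (S.mesh_nonneg i) α) (Nat.cast_nonneg _)
  have hTpos : 0 < T := by linarith [tsum_nonneg (L := .unconditional ℕ) hnn]
  choose F hF hdense using fun K => S.exists_almost_holder hα hTpos K
    ((hsum.sum_le_tsum _ fun i _ => hnn i).trans (by linarith))
  have hmesh : Tendsto (fun K => 7 * S.mesh K) atTop (𝓝 0) := by
    rw [funext fun K => congrArg (7 * ·) (S.mesh_eq K)]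
    simpa using ((tendsto_pow_atTop_nhds_zero_of_lt_one (by norm_num : (0 : ℝ) ≤ 1 / 2)
      (by norm_num)).const_mul (S.mesh 0)).const_mul 7
  have hF' : ∀ K, ∀ s ∈ Set.Icc (0 : ℝ) 1, ∀ t ∈ Set.Icc (0 : ℝ) 1,
      dist (F K s) (F K t) ≤ 12 * T ^ α⁻¹ * |s - t| ^ α⁻¹ + 7 * S.mesh K := fun K s _ t _ => by
    rw [mul_assoc, ← Real.mul_rpow hTpos.le (abs_nonneg _)]
    rcases le_total s t with h | h
    · rw [abs_sub_comm, abs_of_nonneg (sub_nonneg.2 h)]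
      exact hF K s t h
    · rw [abs_of_nonneg (sub_nonneg.2 h), dist_comm]
      exact hF K t s h
  obtain ⟨f, hf, hfC⟩ := exists_holder_surjection_of_almost (inv_pos.2 hα) hmesh hF' hdense
  exact ⟨f, hf, _, by positivity, hfC⟩

theorem exists_connected_cover {X : Type*} [MetricSpace X] [CompactSpace X]
    [LocallyConnectedSpace X] {ε : ℝ} (hε : 0 < ε) :
    ∃ 𝒞 : Finset (Set X), (∀ S ∈ 𝒞, IsConnected S ∧ Metric.diam S ≤ ε) ∧
      ⋃₀ (𝒞 : Set (Set X)) = Set.univ := by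
  classical
  have hmem : ∀ x : X, x ∈ Metric.ball x (ε / 2) := fun x => Metric.mem_ball_self (by positivity)
  obtain ⟨t, ht⟩ := CompactSpace.elim_nhds_subcover
    (fun x : X => connectedComponentIn (Metric.ball x (ε / 2)) x) fun x =>
      Metric.isOpen_ball.connectedComponentIn.mem_nhds (mem_connectedComponentIn (hmem x))
  refine ⟨t.image fun x => connectedComponentIn (Metric.ball x (ε / 2)) x, fun S hS => ?_, ?_⟩
  · obtain ⟨x, -, rfl⟩ := Finset.mem_image.1 hS
    refine ⟨isConnected_connectedComponentIn_iff.2 (hmem x), ?_⟩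
    refine (Metric.diam_mono (connectedComponentIn_subset _ _) Metric.isBounded_ball).trans ?_
    exact (Metric.diam_ball (by positivity)).trans_eq (by ring)
  · rw [Finset.coe_image, Set.sUnion_image]
    exact ht

theorem SXm_le_card {X : Type*} [m : MetricSpace X] {ε : ℝ} {𝒞 : Finset (Set X)}
    (h : ∀ S ∈ 𝒞, IsConnected S ∧ Metric.diam S ≤ ε) (hcov : ⋃₀ (𝒞 : Set (Set X)) = Set.univ) :
    SXm X m ε ≤ 𝒞.card :=
  Nat.sInf_le ⟨𝒞, rfl, h, hcov⟩

theorem exists_card_eq_SXm {X : Type*} [m : MetricSpace X] [CompactSpace X]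
    [LocallyConnectedSpace X] {ε : ℝ} (hε : 0 < ε) :
    ∃ 𝒞 : Finset (Set X), 𝒞.card = SXm X m ε ∧
      (∀ S ∈ 𝒞, IsConnected S ∧ Metric.diam S ≤ ε) ∧ ⋃₀ (𝒞 : Set (Set X)) = Set.univ := by
  obtain ⟨𝒞, h⟩ := exists_connected_cover (X := X) hε
  exact Nat.sInf_mem
    (s := {n | ∃ 𝒞 : Finset (Set X), 𝒞.card = n ∧
      (∀ S ∈ 𝒞, IsConnected S ∧ Metric.diam S ≤ ε) ∧ ⋃₀ (𝒞 : Set (Set X)) = Set.univ})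
    ⟨_, 𝒞, rfl, h⟩

/-- Connected scales obtained from optimal covers by connected sets. -/
theorem exists_connectedScales (X : Type*) [m : MetricSpace X] [CompactSpace X]
    [ConnectedSpace X] [LocallyConnectedSpace X] :
    ∃ (S : ConnectedScales X) (D : ℝ), 0 < D ∧ (∀ k, S.mesh k = D / 2 ^ k) ∧
      ∀ k, (S.cover k).card ≤ SXm X m (D / 2 ^ k) := by
  classical
  set D : ℝ := Metric.diam (Set.univ : Set X) + 1 with hD
  have hDpos : 0 < D := by linarith [Metric.diam_nonneg (s := (Set.univ : Set X))]
  choose 𝒞 hcard h𝒞 hcov using fun k : ℕ =>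
    exists_card_eq_SXm (X := X) (ε := D / 2 ^ k) (by positivity)
  refine ⟨{
    mesh := fun k => D / 2 ^ k
    mesh_nonneg := fun k => by positivity
    mesh_succ := fun k => by rw [pow_succ, div_div]
    cover := fun k => (𝒞 k).image closure
    isClosed := fun k A hA => ?_
    isConnected := fun k A hA => ?_
    dist_le := fun k A hA x hx y hy => ?_
    exists_mem := fun k x => ?_
    card_cover_zero := ?_ }, D, hDpos, fun _ => rfl, fun k =>
      Finset.card_image_le.trans_eq (hcard k)⟩
  · obtain ⟨B, -, rfl⟩ := Finset.mem_image.1 hA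
    exact isClosed_closure
  · obtain ⟨B, hB, rfl⟩ := Finset.mem_image.1 hA
    exact (h𝒞 k B hB).1.closure
  · obtain ⟨B, hB, rfl⟩ := Finset.mem_image.1 hA
    refine (Metric.dist_le_diam_of_mem (Metric.isBounded_of_compactSpace) hx hy).trans ?_
    rw [Metric.diam_closure]
    exact (h𝒞 k B hB).2
  · obtain ⟨B, hB, hx⟩ := Set.mem_sUnion.1 (hcov k ▸ Set.mem_univ x)
    exact ⟨closure B, Finset.mem_image_of_mem _ hB, subset_closure hx⟩
  · refine Finset.card_image_le.trans ((hcard 0).trans_le ?_)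
    refine (SXm_le_card (𝒞 := {Set.univ}) ?_ (by simp)).trans_eq (Finset.card_singleton _)
    intro S hS
    rw [Finset.mem_singleton.1 hS]
    exact ⟨isConnected_univ, by simp [hD]⟩

theorem cast_le_rpow_of_log_div_le {N : ℕ} {ε s : ℝ} (hε : 0 < ε) (hε1 : ε < 1) (hN : 0 < N)
    (h : Real.log N / Real.log (1 / ε) ≤ s) : (N : ℝ) ≤ (1 / ε) ^ s := by
  have hlog : 0 < Real.log (1 / ε) := Real.log_pos (by rwa [one_div, one_lt_inv₀ hε])
  rw [div_le_iff₀ hlog] at h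
  have h1 : (0 : ℝ) < 1 / ε := by positivity
  rw [← Real.log_le_log_iff (by positivity) (by positivity), Real.log_rpow h1]
  exact h

theorem SXm_pos {X : Type*} [m : MetricSpace X] [CompactSpace X] [Nonempty X]
    [LocallyConnectedSpace X] {ε : ℝ} (hε : 0 < ε) : 0 < SXm X m ε := by
  obtain ⟨𝒞, hcard, -, hcov⟩ := exists_card_eq_SXm (X := X) hε
  obtain ⟨A, hA, -⟩ := Set.mem_sUnion.1 (hcov ▸ Set.mem_univ (Classical.arbitrary X))
  exact hcard ▸ Finset.card_pos.2 ⟨A, hA⟩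

theorem summable_of_SDimm_lt {X : Type*} [m : MetricSpace X] [CompactSpace X] [Nonempty X]
    [LocallyConnectedSpace X] (S : ConnectedScales X) {D : ℝ} (hD : 0 < D)
    (hmesh : ∀ k, S.mesh k = D / 2 ^ k) (hcard : ∀ k, (S.cover k).card ≤ SXm X m (D / 2 ^ k))
    {s : NNReal} (hs : SDimm X m < s) {α : ℝ} (hα : 2 * (s : ℝ) < α) :
    Summable fun i => S.mesh i ^ α * S.segmentCount i := by
  have hs0 : 0 ≤ (s : ℝ) := s.2
  have hlim : Tendsto (fun k : ℕ => D / 2 ^ k) atTop (𝓝[>] 0) := by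
    refine tendsto_nhdsWithin_iff.2 ⟨?_, .of_forall fun k => Set.mem_Ioi.2 (by positivity)⟩
    exact tendsto_const_nhds.div_atTop (tendsto_pow_atTop_atTop_of_one_lt (by norm_num))
  have hev : ∀ᶠ k : ℕ in atTop, ((S.cover k).card : ℝ) ≤ (1 / (D / 2 ^ k)) ^ (s : ℝ) := by
    have h1 : ∀ᶠ ε : ℝ in 𝓝[>] 0, ε < 1 := nhdsWithin_le_nhds (Iio_mem_nhds one_pos)
    filter_upwards [hlim.eventually (Filter.eventually_lt_of_limsup_lt hs), hlim.eventually h1]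
      with k hk hk1
    refine (Nat.cast_le.2 (hcard k)).trans
      (cast_le_rpow_of_log_div_le (by positivity) hk1 (SXm_pos (by positivity)) ?_)
    have := ENNReal.ofReal_le_iff_le_toReal ENNReal.coe_ne_top |>.1 hk.le
    simpa using this
  set q : ℝ := 2 ^ (s : ℝ) with hq
  have hq1 : 1 ≤ q := Real.one_le_rpow (by norm_num) hs0
  obtain ⟨C, hC1, hC⟩ : ∃ C : ℝ, 1 ≤ C ∧ ∀ k, ((S.cover k).card : ℝ) ≤ C * q ^ k := by
    obtain ⟨k₀, hk₀⟩ := Filter.eventually_atTop.1 hev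
    refine ⟨1 + (1 / D) ^ (s : ℝ) + ∑ k ∈ Finset.range k₀, ((S.cover k).card : ℝ), ?_, fun k => ?_⟩
    · have : 0 ≤ ∑ k ∈ Finset.range k₀, ((S.cover k).card : ℝ) :=
        Finset.sum_nonneg fun _ _ => Nat.cast_nonneg _
      have : 0 ≤ (1 / D) ^ (s : ℝ) := by positivity
      linarith
    · have hqk : 1 ≤ q ^ k := one_le_pow₀ hq1
      have h0 : 0 ≤ ∑ k ∈ Finset.range k₀, ((S.cover k).card : ℝ) :=
        Finset.sum_nonneg fun _ _ => Nat.cast_nonneg _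
      have h1 : 0 ≤ (1 / D) ^ (s : ℝ) := by positivity
      rcases lt_or_ge k k₀ with hk | hk
      · have := Finset.single_le_sum (f := fun k => ((S.cover k).card : ℝ))
          (fun _ _ => Nat.cast_nonneg _) (Finset.mem_range.2 hk)
        nlinarith
      · have := hk₀ k hk
        have heq : (1 / (D / 2 ^ k)) ^ (s : ℝ) = (1 / D) ^ (s : ℝ) * q ^ k := by
          rw [one_div_div, ← mul_one_div, mul_comm, Real.mul_rpow (by positivity) (by positivity),
            hq, ← Real.rpow_natCast, ← Real.rpow_natCast, ← Real.rpow_mul (by norm_num),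
            ← Real.rpow_mul (by norm_num), mul_comm (k : ℝ)]
        rw [heq] at this
        nlinarith
  have hcount : ∀ i, (S.segmentCount i : ℝ) ≤ 3 * C ^ 2 * ((i + 1) * (q ^ 2) ^ i) := by
    intro i
    have hqi : 1 ≤ q ^ i := one_le_pow₀ hq1
    have h₁ : (2 * ((S.cover i).card : ℝ) + 1) ≤ 3 * (C * q ^ i) := by nlinarith [hC i]
    have h₂ : ∑ k ∈ Finset.range (i + 1), ((S.cover k).card : ℝ) ≤ (i + 1) * (C * q ^ i) := by
      refine (Finset.sum_le_card_nsmul _ _ (C * q ^ i) fun k hk => (hC k).trans ?_).trans ?_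
      · exact mul_le_mul_of_nonneg_left
          (pow_le_pow_right₀ hq1 (Nat.lt_succ_iff.1 (Finset.mem_range.1 hk))) (by linarith)
      · simp
    rw [ConnectedScales.segmentCount]
    push_cast
    calc _ ≤ 3 * (C * q ^ i) * ((i + 1) * (C * q ^ i)) :=
          mul_le_mul h₁ h₂ (Finset.sum_nonneg fun _ _ => Nat.cast_nonneg _) (by positivity)
      _ = _ := by ring
  set r : ℝ := q ^ 2 * (1 / 2) ^ α with hr
  have hr1 : ‖r‖ < 1 := by
    rw [Real.norm_of_nonneg (by positivity), hr, hq, ← Real.rpow_natCast, ← Real.rpow_mul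
      (by norm_num), one_div, Real.inv_rpow (by norm_num), ← Real.rpow_neg (by norm_num),
      ← Real.rpow_add (by norm_num)]
    refine Real.rpow_lt_one_of_one_lt_of_neg (by norm_num) ?_
    push_cast
    linarith
  have hsumm : Summable fun i : ℕ => D ^ α * (3 * C ^ 2) * ((i + 1) * r ^ i) := by
    refine Summable.mul_left _ ?_
    simp_rw [add_mul, one_mul]
    refine Summable.add ?_ (summable_geometric_of_norm_lt_one hr1)
    simpa using summable_pow_mul_geometric_of_norm_lt_one 1 hr1
  refine Summable.of_nonneg_of_le (fun i => ?_) (fun i => ?_) hsumm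
  · exact mul_nonneg (Real.rpow_nonneg (S.mesh_nonneg i) α) (Nat.cast_nonneg _)
  · have hpow : S.mesh i ^ α = D ^ α * ((1 / 2) ^ α) ^ i := by
      rw [hmesh, div_eq_mul_one_div, ← one_div_pow, Real.mul_rpow hD.le (by positivity),
        ← Real.rpow_natCast, ← Real.rpow_natCast, ← Real.rpow_mul (by norm_num),
        ← Real.rpow_mul (by norm_num), mul_comm (i : ℝ)]
    rw [hpow]
    refine (mul_le_mul_of_nonneg_left (hcount i) (by positivity)).trans_eq ?_
    rw [hr]
    ring

theorem HoDimm_le_two_mul_SDimm (X : Type*) [m : MetricSpace X] [CompactSpace X]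
    [ConnectedSpace X] [LocallyConnectedSpace X] : HoDimm X m ≤ 2 * SDimm X m := by
  refine le_of_forall_gt_imp_ge_of_dense fun a ha => ?_
  have h2 : (2 : ENNReal) ≠ 0 := two_ne_zero
  rw [mul_comm, ← ENNReal.lt_div_iff_mul_lt (Or.inl h2) (Or.inl ENNReal.ofNat_ne_top)] at ha
  obtain ⟨s, hs, hsa⟩ := ENNReal.lt_iff_exists_nnreal_btwn.1 ha
  rw [ENNReal.lt_div_iff_mul_lt (Or.inl h2) (Or.inl ENNReal.ofNat_ne_top)] at hsa
  obtain ⟨α, hα, hαa⟩ := ENNReal.lt_iff_exists_nnreal_btwn.1 hsa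
  have hα' : 2 * (s : ℝ) < α := by
    have : s * 2 < α := by exact_mod_cast hα
    rw [mul_comm]
    exact_mod_cast this
  have hαpos : 0 < α := lt_of_le_of_lt (zero_le (a := s * 2)) (by exact_mod_cast hα)
  obtain ⟨S, D, hD, hmesh, hcard⟩ := exists_connectedScales X
  obtain ⟨f, hf, C, hC, hfC⟩ := S.exists_holder_surjection (α := α) (by exact_mod_cast hαpos)
    (summable_of_SDimm_lt S hD hmesh hcard hs hα')
  refine (sInf_le ?_).trans hαa.le
  refine ⟨by exact_mod_cast hαpos, f, hf, C, hC, ?_⟩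
  simpa [ENNReal.toReal_inv] using hfC

theorem BoxDimm_le_SDimm (X : Type*) [m : MetricSpace X] [CompactSpace X]
    [LocallyConnectedSpace X] [Nonempty X] : BoxDimm X m ≤ SDimm X m := by
  refine Filter.limsup_le_limsup ?_
  have h1 : ∀ᶠ ε : ℝ in 𝓝[>] 0, ε < 1 := nhdsWithin_le_nhds (Iio_mem_nhds one_pos)
  filter_upwards [h1, self_mem_nhdsWithin] with ε hε1 hε
  have hε : 0 < ε := hε
  refine ENNReal.ofReal_le_ofReal (div_le_div_of_nonneg_right ?_ (Real.log_nonneg ?_))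
  · have hle : NXm X m ε ≤ SXm X m ε := by
      obtain ⟨𝒞, hcard, h, hcov⟩ := exists_card_eq_SXm (X := X) hε
      exact Nat.sInf_le ⟨𝒞, hcard, fun S hS => (h S hS).2, hcov⟩
    rcases Nat.eq_zero_or_pos (NXm X m ε) with h0 | hpos
    · rw [h0, Nat.cast_zero, Real.log_zero]
      exact Real.log_natCast_nonneg _
    · exact Real.log_le_log (by exact_mod_cast hpos) (by exact_mod_cast hle)
  · rw [one_div]
    exact (one_le_inv₀ hε).2 hε1.le

theorem SXm_le_of_holder {X : Type*} [m : MetricSpace X] {f : ℝ → X}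
    (hf : f '' Set.Icc 0 1 = Set.univ) {C β : ℝ} (hC : 0 < C) (hβ : 0 < β)
    (hfC : ∀ x ∈ Set.Icc (0 : ℝ) 1, ∀ y ∈ Set.Icc (0 : ℝ) 1, dist (f x) (f y) ≤ C * |x - y| ^ β)
    {ε : ℝ} {n : ℕ} (hn : 0 < n) (hε : C * (1 / n : ℝ) ^ β ≤ ε) : SXm X m ε ≤ n := by
  classical
  have hn' : (0 : ℝ) < n := by exact_mod_cast hn
  let J : ℕ → Set ℝ := fun i => Set.Icc (i / n : ℝ) ((i + 1) / n)
  have hJ : ∀ i < n, J i ⊆ Set.Icc 0 1 := fun i hi => by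
    refine Set.Icc_subset_Icc (by positivity) ((div_le_one hn').2 ?_)
    exact_mod_cast hi
  have hcont : ContinuousOn f (Set.Icc 0 1) := by
    have hH : HolderOnWith C.toNNReal β.toNNReal f (Set.Icc 0 1) := by
      intro x hx y hy
      rw [edist_dist, edist_dist, Real.coe_toNNReal β hβ.le,
        ENNReal.ofReal_rpow_of_nonneg dist_nonneg hβ.le, ← ENNReal.ofReal.eq_1,
        ← ENNReal.ofReal_mul hC.le]
      exact ENNReal.ofReal_le_ofReal (hfC x hx y hy)
    exact hH.continuousOn (Real.toNNReal_pos.2 hβ)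
  refine (SXm_le_card (𝒞 := (Finset.range n).image fun i => f '' J i) ?_ ?_).trans
    (Finset.card_image_le.trans_eq (Finset.card_range n))
  · intro S hS
    obtain ⟨i, hi, rfl⟩ := Finset.mem_image.1 hS
    have hi := Finset.mem_range.1 hi
    have hle : (i / n : ℝ) ≤ (i + 1) / n := by gcongr; linarith
    refine ⟨(isConnected_Icc hle).image _ (hcont.mono (hJ i hi)), ?_⟩
    refine Metric.diam_le_of_forall_dist_le (hε.trans' (by positivity)) ?_
    rintro _ ⟨x, hx, rfl⟩ _ ⟨y, hy, rfl⟩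
    refine (hfC x (hJ i hi hx) y (hJ i hi hy)).trans (hε.trans' ?_)
    refine mul_le_mul_of_nonneg_left (Real.rpow_le_rpow (abs_nonneg _) ?_ hβ.le) hC.le
    have := Real.dist_le_of_mem_Icc hx hy
    rw [Real.dist_eq] at this
    exact this.trans_eq (by ring)
  · rw [Finset.coe_image, Set.sUnion_image, Set.eq_univ_iff_forall]
    intro z
    obtain ⟨x, hx, rfl⟩ : z ∈ f '' Set.Icc 0 1 := hf ▸ Set.mem_univ z
    rw [Set.mem_iUnion₂]
    rcases hx.2.eq_or_lt with rfl | hx1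
    · refine ⟨n - 1, by simpa using hn, 1, ⟨?_, ?_⟩, rfl⟩
      · rw [div_le_one hn']; exact_mod_cast Nat.sub_le n 1
      · rw [Nat.cast_sub hn, Nat.cast_one, sub_add_cancel, div_self hn'.ne']
    · have h0 : 0 ≤ x * n := mul_nonneg hx.1 hn'.le
      refine ⟨⌊x * n⌋₊, ?_, x, ⟨?_, ?_⟩, rfl⟩
      · simp only [Finset.coe_range, Set.mem_Iio]
        exact (Nat.floor_lt h0).2 (by nlinarith)
      · rw [div_le_iff₀ hn']; exact Nat.floor_le h0
      · rw [le_div_iff₀ hn']; exact (Nat.lt_floor_add_one _).le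

theorem SDimm_le_HoDimm (X : Type*) [m : MetricSpace X] [CompactSpace X]
    [LocallyConnectedSpace X] [Nonempty X] : SDimm X m ≤ HoDimm X m := by
  refine le_sInf ?_
  rintro α ⟨hα, f, hf, C, hC, hfC⟩
  refine le_of_forall_gt_imp_ge_of_dense fun b hb => ?_
  obtain ⟨α', hαα', hα'b⟩ := ENNReal.lt_iff_exists_nnreal_btwn.1 hb
  refine le_trans ?_ hα'b.le
  lift α to NNReal using (hαα'.trans ENNReal.coe_lt_top).ne
  have hαpos : (0 : ℝ) < α := by exact_mod_cast hα
  have hlt : (α : ℝ) < α' := by exact_mod_cast hαα'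
  rw [ENNReal.toReal_inv, ENNReal.coe_toReal] at hfC
  have hlim : Tendsto (fun ε : ℝ => C ^ (α : ℝ) * ε ^ ((α' : ℝ) - α) + ε ^ (α' : ℝ))
      (𝓝[>] 0) (𝓝 0) := by
    have key : ∀ p : ℝ, 0 < p → Tendsto (fun ε : ℝ => ε ^ p) (𝓝[>] 0) (𝓝 0) := fun p hp => by
      have := (Real.continuousAt_rpow_const 0 p (Or.inr hp.le)).tendsto
      rw [Real.zero_rpow hp.ne'] at this
      exact this.mono_left nhdsWithin_le_nhds
    simpa using ((key _ (sub_pos.2 hlt)).const_mul (C ^ (α : ℝ))).add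
      (key _ (hαpos.trans hlt))
  have h1 : ∀ᶠ ε : ℝ in 𝓝[>] 0, ε < 1 := nhdsWithin_le_nhds (Iio_mem_nhds one_pos)
  refine Filter.limsup_le_of_le (h := ?_)
  filter_upwards [h1, self_mem_nhdsWithin, hlim.eventually (Iio_mem_nhds one_pos)]
    with ε hε1 hε hsmall
  have hε : 0 < ε := hε
  set n : ℕ := ⌈(C / ε) ^ (α : ℝ)⌉₊ with hn
  have hpos : 0 < (C / ε) ^ (α : ℝ) := by positivity
  have hnpos : 0 < n := Nat.ceil_pos.2 hpos
  have hn' : (0 : ℝ) < n := by exact_mod_cast hnpos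
  have hSn : SXm X m ε ≤ n := by
    refine SXm_le_of_holder hf hC (inv_pos.2 hαpos) hfC hnpos ?_
    have h₁ : C / ε ≤ (n : ℝ) ^ (α : ℝ)⁻¹ := by
      rw [← Real.rpow_rpow_inv (by positivity : 0 ≤ C / ε) hαpos.ne']
      exact Real.rpow_le_rpow hpos.le (Nat.le_ceil _) (inv_nonneg.2 hαpos.le)
    rw [one_div, Real.inv_rpow hn'.le, ← div_eq_mul_inv, div_le_iff₀ (by positivity), mul_comm]
    exact (div_le_iff₀ hε).1 h₁
  have hle : (SXm X m ε : ℝ) ≤ (1 / ε) ^ (α' : ℝ) := by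
    have h₁ : (n : ℝ) < (C / ε) ^ (α : ℝ) + 1 := Nat.ceil_lt_add_one hpos.le
    have h₂ : (SXm X m ε : ℝ) ≤ n := by exact_mod_cast hSn
    have hp : 0 < ε ^ (α' : ℝ) := by positivity
    rw [one_div, Real.inv_rpow hε.le, ← one_div, le_div_iff₀ hp]
    have h₃ : (C / ε) ^ (α : ℝ) * ε ^ (α' : ℝ) = C ^ (α : ℝ) * ε ^ ((α' : ℝ) - α) := by
      rw [Real.div_rpow hC.le hε.le, Real.rpow_sub hε]
      ring
    have hsmall : C ^ (α : ℝ) * ε ^ ((α' : ℝ) - α) + ε ^ (α' : ℝ) < 1 := hsmall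
    nlinarith
  have hlog : 0 < Real.log (1 / ε) := Real.log_pos (by rwa [one_div, one_lt_inv₀ hε])
  have hSpos : (0 : ℝ) < SXm X m ε := by exact_mod_cast SXm_pos (X := X) hε
  rw [← ENNReal.ofReal_coe_nnreal]
  refine ENNReal.ofReal_le_ofReal ((div_le_iff₀ hlog).2 ?_)
  rw [← Real.log_rpow (by positivity)]
  exact Real.log_le_log hSpos hle

/-- For a Peano continuum `X`, with infima over all admissible metrics (metrics generating
the topology of `X`):
`dim(X) ≤ S-dim(X) ≤ Hö-dim(X) ≤ 2·S-dim(X)`, where by the Pontrjagin–Schnirelman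
theorem the covering dimension `dim(X)` equals the infimum of box-counting dimensions. -/
theorem dim_le_sdim_le_hodim_le_two_sdim (X : Type*) [t : TopologicalSpace X]
    [CompactSpace X] [ConnectedSpace X] [LocallyConnectedSpace X] [Nonempty X]
    [TopologicalSpace.MetrizableSpace X] :
    (⨅ d : {d : MetricSpace X // d.toUniformSpace.toTopologicalSpace = t},
        BoxDimm X d.1) ≤
      (⨅ d : {d : MetricSpace X // d.toUniformSpace.toTopologicalSpace = t},
        SDimm X d.1) ∧
    (⨅ d : {d : MetricSpace X // d.toUniformSpace.toTopologicalSpace = t},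
        SDimm X d.1) ≤
      (⨅ d : {d : MetricSpace X // d.toUniformSpace.toTopologicalSpace = t},
        HoDimm X d.1) ∧
    (⨅ d : {d : MetricSpace X // d.toUniformSpace.toTopologicalSpace = t},
        HoDimm X d.1) ≤
      2 * ⨅ d : {d : MetricSpace X // d.toUniformSpace.toTopologicalSpace = t},
        SDimm X d.1 := by
  refine ⟨iInf_mono ?_, iInf_mono ?_, ?_⟩
  · rintro ⟨m, rfl⟩
    exact BoxDimm_le_SDimm X
  · rintro ⟨m, rfl⟩
    exact SDimm_le_HoDimm X
  · rw [ENNReal.mul_iInf_of_ne two_ne_zero ENNReal.ofNat_ne_top]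
    refine iInf_mono ?_
    rintro ⟨m, rfl⟩
    exact HoDimm_le_two_mul_SDimm X
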